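/- arXiv:2001.11230 — 3 statements merged into one kernel-verified Lean document; each statement's English description precedes it below -/
import Mathlib

section
/- Let q ≥ 2 and d be integers with 2^{q-1} ≤ d < 2^q, let α_0, …, α_{q-1} ∈ {0,1} be the binary digits of d−1 (so d−1 = Σ_{i=0}^{q-1} α_i 2^i), let r > 0 and γ be real numbers, and let ω_1, …, ω_{q-1} be nonnegative reals satisfying r² ≤ ω_{q-1}·r^{1-α_{q-1}}, ω_{i+1}² ≤ ω_i·r^{1-α_i} for i = 1, …, q−2, and ω_1² ≤ γ·r^{1-α_0}. Then r^{2^q} ≤ γ·r^{2^q − d}, and consequently r^d ≤ γ. -/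
/-- the chain of rotated SOC constraints implies
`r^(2^q) ≤ γ * r^(2^q - d)` and consequently `r^d ≤ γ`. -/
theorem soc_constraints_imply_pow_le
    (q d : ℕ) (hq : 2 ≤ q)
    (hlow : 2 ^ (q - 1) ≤ d) (hhigh : d < 2 ^ q)
    (α : ℕ → ℕ) (hα : ∀ i, α i = 0 ∨ α i = 1)
    (hdigits : d - 1 = ∑ i ∈ Finset.range q, α i * 2 ^ i)
    (r γ : ℝ) (hr : 0 < r)
    (ω : ℕ → ℝ) (hω : ∀ i, 1 ≤ i → i ≤ q - 1 → 0 ≤ ω i)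
    (h1 : r ^ 2 ≤ ω (q - 1) * r ^ (1 - α (q - 1)))
    (h2 : ∀ i, 1 ≤ i → i ≤ q - 2 → ω (i + 1) ^ 2 ≤ ω i * r ^ (1 - α i))
    (h3 : ω 1 ^ 2 ≤ γ * r ^ (1 - α 0)) :
    r ^ (2 ^ q) ≤ γ * r ^ (2 ^ q - d) ∧ r ^ d ≤ γ := by
  have step : ∀ k (x y : ℝ), x ^ 2 ≤ y * r ^ (1 - α k) →
      y ^ 2 ^ k ≤ γ * r ^ (∑ i ∈ Finset.range k, (1 - α i) * 2 ^ i) →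
      x ^ 2 ^ (k + 1) ≤ γ * r ^ (∑ i ∈ Finset.range (k + 1), (1 - α i) * 2 ^ i) := by
    intro k x y hxy hy
    calc x ^ 2 ^ (k + 1) = (x ^ 2) ^ 2 ^ k := by rw [← pow_mul, pow_succ, mul_comm]
      _ ≤ (y * r ^ (1 - α k)) ^ 2 ^ k := pow_le_pow_left₀ (sq_nonneg x) hxy _
      _ = y ^ 2 ^ k * r ^ ((1 - α k) * 2 ^ k) := by rw [mul_pow, ← pow_mul]
      _ ≤ (γ * r ^ (∑ i ∈ Finset.range k, (1 - α i) * 2 ^ i)) * r ^ ((1 - α k) * 2 ^ k) :=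
          mul_le_mul_of_nonneg_right hy (by positivity)
      _ = _ := by rw [Finset.sum_range_succ, pow_add, mul_assoc]
  have key : ∀ k, 1 ≤ k → k ≤ q - 1 →
      ω k ^ 2 ^ k ≤ γ * r ^ (∑ i ∈ Finset.range k, (1 - α i) * 2 ^ i) := by
    intro k hk
    induction k, hk using Nat.le_induction with
    | base => intro _; simpa using h3
    | succ k hk ih =>
      intro hkq
      exact step k _ _ (h2 k hk (by omega)) (ih (by omega))
  have hsum : ∀ k, (∑ i ∈ Finset.range k, (1 - α i) * 2 ^ i)
      + (∑ i ∈ Finset.range k, α i * 2 ^ i) + 1 = 2 ^ k := by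
    intro k
    induction k with
    | zero => simp
    | succ k ih =>
      rw [Finset.sum_range_succ, Finset.sum_range_succ, pow_succ]
      rcases hα k with h | h <;> simp only [h] <;> omega
  have hd : 1 ≤ d := le_trans Nat.one_le_two_pow hlow
  have hS : (∑ i ∈ Finset.range q, (1 - α i) * 2 ^ i) = 2 ^ q - d := by
    have := hsum q
    omega
  have main := step (q - 1) r (ω (q - 1)) h1 (key (q - 1) (by omega) le_rfl)
  rw [show q - 1 + 1 = q by omega, hS] at main
  refine ⟨main, ?_⟩
  have h : r ^ 2 ^ q = r ^ d * r ^ (2 ^ q - d) := by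
    rw [← pow_add]; congr 1; omega
  rw [h] at main
  exact le_of_mul_le_mul_right main (by positivity)
end

section
/- Let N be a finite set, let w : N × N → ℝ satisfy w(i,j) ≥ 0 for all i, j ∈ N, let u, v : N → ℝ satisfy u(i) ∈ {0,1} and v(j) ∈ {0,1} for all i, j ∈ N, let D ≥ 0 be a real number, and let μ be a real number. Then μ ≥ D·Σ_{(i,j) ∈ N×N} w(i,j)·u(i)·v(j) holds if and only if for every subset S ⊆ N × N one has μ ≥ D·Σ_{(i,j) ∈ S} w(i,j)·(u(i) + v(j) − 1). -/
/-- Proposition `propo:1` of the paper: the bilinear inter-hub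
cost constraint `μ ≥ D·Σ_{(i,j)} w(i,j)·u(i)·v(j)` is equivalent to the
exponential family of linear constraints indexed by subsets `S ⊆ N × N`. -/
theorem bilinear_constraint_iff_subset_family
    {N : Type*} [Fintype N]
    (w : N × N → ℝ) (hw : ∀ i j, 0 ≤ w (i, j))
    (u v : N → ℝ)
    (hu : ∀ i, u i = 0 ∨ u i = 1) (hv : ∀ j, v j = 0 ∨ v j = 1)
    (D : ℝ) (hD : 0 ≤ D) (μ : ℝ) :
    μ ≥ D * ∑ p : N × N, w p * u p.1 * v p.2 ↔
      ∀ S : Finset (N × N), μ ≥ D * ∑ p ∈ S, w p * (u p.1 + v p.2 - 1) := by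
  classical
  constructor
  · intro h S
    refine le_trans (mul_le_mul_of_nonneg_left ?_ hD) h
    calc ∑ p ∈ S, w p * (u p.1 + v p.2 - 1)
        ≤ ∑ p ∈ S, w p * u p.1 * v p.2 := by
          refine Finset.sum_le_sum fun p _ => ?_
          have := hw p.1 p.2
          rcases hu p.1 with a | a <;> rcases hv p.2 with b | b <;> simp [a, b] <;> exact this
      _ ≤ ∑ p : N × N, w p * u p.1 * v p.2 := by
          refine Finset.sum_le_sum_of_subset_of_nonneg (Finset.subset_univ S) fun p _ _ => ?_
          have := hw p.1 p.2
          rcases hu p.1 with a | a <;> rcases hv p.2 with b | b <;> simp [a, b] <;> exact this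
  · intro h
    have h1 := h (Finset.univ.filter fun p => u p.1 = 1 ∧ v p.2 = 1)
    rw [Finset.sum_filter] at h1
    convert h1 using 3 with p
    rcases hu p.1 with a | a <;> rcases hv p.2 with b | b <;> simp [a, b]
end

section
/- Let N be a finite set, let w : N × N → ℝ satisfy w(i,j) ≥ 0 for all i, j ∈ N, let u, v : N → ℝ satisfy u(i) ∈ {0,1} and v(j) ∈ {0,1} for all i, j ∈ N, let D and D̂ be real numbers with 0 ≤ D ≤ D̂, and let μ be a real number. Then the following are equivalent: (1) for every subset S ⊆ N × N, μ ≥ D·Σ_{(i,j) ∈ S} w(i,j)·(u(i) + v(j) − 1); (2) there exist functions θ, ρ : N → ℝ such that for all i ∈ N: θ(i) ≥ D − D̂·(1 − u(i)), θ(i) ≥ 0, ρ(i) ≥ D − D̂·(1 − v(i)), ρ(i) ≥ 0, and for every subset S ⊆ N × N, μ ≥ Σ_{(i,j) ∈ S} w(i,j)·(θ(i) + ρ(j) − D). -/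
/-- the nonlinear exponential family of constraints
`μ ≥ D·Σ_{(i,j)∈S} w(i,j)·(u(i)+v(j)−1)` (for all `S ⊆ N × N`) is equivalent
to the existence of McCormick variables `θ, ρ` satisfying the big-M
constraints together with the linear family
`μ ≥ Σ_{(i,j)∈S} w(i,j)·(θ(i)+ρ(j)−D)` (for all `S ⊆ N × N`). -/
theorem exponential_family_iff_mccormick
    {N : Type*} [Fintype N]
    (w : N × N → ℝ) (hw : ∀ i j, 0 ≤ w (i, j))
    (u v : N → ℝ)
    (hu : ∀ i, u i = 0 ∨ u i = 1) (hv : ∀ j, v j = 0 ∨ v j = 1)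
    (D Dhat : ℝ) (hD : 0 ≤ D) (hDhat : D ≤ Dhat) (μ : ℝ) :
    (∀ S : Finset (N × N), μ ≥ D * ∑ p ∈ S, w p * (u p.1 + v p.2 - 1)) ↔
      (∃ θ ρ : N → ℝ,
        (∀ i, θ i ≥ D - Dhat * (1 - u i)) ∧ (∀ i, θ i ≥ 0) ∧
        (∀ i, ρ i ≥ D - Dhat * (1 - v i)) ∧ (∀ i, ρ i ≥ 0) ∧
        (∀ S : Finset (N × N), μ ≥ ∑ p ∈ S, w p * (θ p.1 + ρ p.2 - D))) := by
  constructor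
  · intro h
    refine ⟨fun i => D * u i, fun j => D * v j, ?_, ?_, ?_, ?_, ?_⟩
    · intro i
      rcases hu i with h1 | h1 <;> simp only [h1] <;> linarith
    · intro i
      rcases hu i with h1 | h1 <;> simp only [h1] <;> linarith
    · intro i
      rcases hv i with h1 | h1 <;> simp only [h1] <;> linarith
    · intro i
      rcases hv i with h1 | h1 <;> simp only [h1] <;> linarith
    · intro S
      have h2 := h S
      rw [Finset.mul_sum] at h2
      refine le_trans (le_of_eq ?_) h2
      apply Finset.sum_congr rfl
      intro p _
      ring
  · rintro ⟨θ, ρ, h1, h2, h3, h4, h5⟩ S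
    refine le_trans ?_ (h5 S)
    rw [Finset.mul_sum]
    apply Finset.sum_le_sum
    intro p _
    have hθ : D * u p.1 ≤ θ p.1 := by
      have a := h1 p.1
      have b := h2 p.1
      rcases hu p.1 with h | h <;> rw [h] at a ⊢ <;> linarith
    have hρ : D * v p.2 ≤ ρ p.2 := by
      have a := h3 p.2
      have b := h4 p.2
      rcases hv p.2 with h | h <;> rw [h] at a ⊢ <;> linarith
    have := mul_le_mul_of_nonneg_left (add_le_add hθ hρ) (hw p.1 p.2)
    simp only [Prod.mk.eta] at this
    linarith
end
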